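/- No critical graph G has pairwise distinct vertices x, y, z such that x is adjacent to both y and z, d_G(z) < 2Δ(G) − d_G(x) − d_G(y) + 2, and x and z have at least d_G(x) + d_G(y) − Δ(G) − 2 common neighbors distinct from y (i.e., the edge xz lies in at least d_G(x) + d_G(y) − Δ(G) − 2 triangles not containing y). -/

import Mathlib

open SimpleGraph

variable {V : Type*}

/-- `c` is a proper edge coloring of `G` using colors `0, …, n-1`:
every edge gets a color `< n`, and distinct edges sharing an endpoint
receive distinct colors. -/
def IsProperEdgeColoring (G : SimpleGraph V) (n : ℕ) (c : Sym2 V → ℕ) : Prop :=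
  (∀ e ∈ G.edgeSet, c e < n) ∧
    ∀ e₁ ∈ G.edgeSet, ∀ e₂ ∈ G.edgeSet, e₁ ≠ e₂ → (∃ v, v ∈ e₁ ∧ v ∈ e₂) →
      c e₁ ≠ c e₂

/-- The edge chromatic number `χ'(G)`: the least number of colors in a proper
edge coloring of `G`. -/
noncomputable def edgeChromaticNumber (G : SimpleGraph V) : ℕ :=
  sInf {n | ∃ c, IsProperEdgeColoring G n c}

/-- The degree `d_G(v)` of a vertex. -/
noncomputable def deg (G : SimpleGraph V) (v : V) : ℕ := (G.neighborSet v).ncard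

/-- The maximum vertex degree `Δ(G)`. -/
noncomputable def maxDeg (G : SimpleGraph V) : ℕ := sSup {d | ∃ v, deg G v = d}

/-- `G` is critical: it is class 2 (i.e. `χ'(G) ≠ Δ(G)`) and every proper
subgraph `H` of `G` satisfies `χ'(H) < χ'(G)`. -/
def IsCritical (G : SimpleGraph V) : Prop :=
  edgeChromaticNumber G ≠ maxDeg G ∧
    ∀ H : G.Subgraph, H ≠ ⊤ → edgeChromaticNumber H.coe < edgeChromaticNumber G

/-- `G` is `k`-critical: critical with maximum degree `k`. -/
def IsKCritical (G : SimpleGraph V) (k : ℕ) : Prop :=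
  IsCritical G ∧ maxDeg G = k

/-- `c u v` is the color of the edge `uv` in a proper edge coloring of `H` with
colors `0, …, m-1`; values at non-edges are irrelevant. -/
structure IsEdgeCol (H : SimpleGraph V) (m : ℕ) (c : V → V → ℕ) : Prop where
  symm : ∀ u v, H.Adj u v → c u v = c v u
  lt : ∀ u v, H.Adj u v → c u v < m
  proper : ∀ u v w, H.Adj u v → H.Adj u w → c u v = c u w → v = w

/-- No edge of `H` at `v` has color `k`. -/
def MissesColor (H : SimpleGraph V) (c : V → V → ℕ) (v : V) (k : ℕ) : Prop :=
  ∀ w, H.Adj v w → c v w ≠ k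

theorem MissesColor.of_row_eq {H : SimpleGraph V} {c c' : V → V → ℕ} {v : V} {k : ℕ}
    (h : MissesColor H c v k) (hr : ∀ w, c' v w = c v w) : MissesColor H c' v k :=
  fun w hw => by rw [hr]; exact h w hw

theorem MissesColor.of_row_swap {H : SimpleGraph V} {c c' : V → V → ℕ} {v : V} {f h k : ℕ}
    (hr : ∀ w, c' v w = Equiv.swap f h (c v w)) (hk : MissesColor H c v (Equiv.swap f h k)) :
    MissesColor H c' v k := fun w hw e => hk w hw <| by
  rw [← e, hr, Equiv.swap_apply_self]

/-- A connected graph of maximum degree at most two has at most two vertices of degree at most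
one. -/
theorem not_reachable_of_degree_le_two [Fintype V] [DecidableEq V] (K : SimpleGraph V)
    [DecidableRel K.Adj] (h2 : ∀ v, K.degree v ≤ 2) {x y z : V} (hxy : x ≠ y) (hxz : x ≠ z)
    (hyz : y ≠ z) (hx : K.degree x ≤ 1) (hy : K.degree y ≤ 1) (hz : K.degree z ≤ 1)
    (rxy : K.Reachable x y) (rxz : K.Reachable x z) : False := by
  classical
  let C := K.connectedComponentMk x
  have hC : C.toSimpleGraph.Connected := C.connected_toSimpleGraph
  have hcard := hC.card_vert_le_card_edgeSet_add_one
  have hsum := C.toSimpleGraph.sum_degrees_eq_twice_card_edges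
  rw [Nat.card_eq_fintype_card, Nat.card_eq_fintype_card,
    SimpleGraph.card_edgeSet] at hcard
  have hdeg : ∀ v : C, C.toSimpleGraph.degree v ≤ K.degree v := by
    intro v
    rw [← SimpleGraph.card_neighborFinset_eq_degree, ← SimpleGraph.card_neighborFinset_eq_degree]
    refine Finset.card_le_card_of_injOn Subtype.val ?_ Subtype.val_injective.injOn
    intro w hw
    exact (SimpleGraph.mem_neighborFinset _ _ _).2
      ((SimpleGraph.mem_neighborFinset C.toSimpleGraph v w).1 hw)
  let x' : C := ⟨x, rfl⟩
  let y' : C := ⟨y, SimpleGraph.ConnectedComponent.eq.2 rxy.symm⟩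
  let z' : C := ⟨z, SimpleGraph.ConnectedComponent.eq.2 rxz.symm⟩
  have hle : ∀ v : C, C.toSimpleGraph.degree v + (if v ∈ ({x', y', z'} : Finset C) then 1 else 0)
      ≤ 2 := by
    intro v
    have := hdeg v
    have := h2 v
    split_ifs with hv
    · simp only [Finset.mem_insert, Finset.mem_singleton] at hv
      have : K.degree v ≤ 1 := by
        rcases hv with rfl | rfl | rfl <;> assumption
      omega
    · omega
  have hs := Finset.sum_le_sum fun v (_ : v ∈ (Finset.univ : Finset C)) => hle v
  rw [Finset.sum_add_distrib, Finset.sum_boole, Finset.filter_univ_mem, Finset.sum_const,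
    Finset.card_univ, Finset.card_eq_three.2 ⟨x', y', z', fun e => hxy (congrArg Subtype.val e),
      fun e => hxz (congrArg Subtype.val e), fun e => hyz (congrArg Subtype.val e), rfl⟩] at hs
  simp only [smul_eq_mul, Nat.cast_ofNat] at hs
  omega

/-- Exchanging two colors on a set closed under the edges of these colors. -/
theorem IsEdgeCol.swap_on {H : SimpleGraph V} {m : ℕ} {c : V → V → ℕ} (hc : IsEdgeCol H m c)
    {f h : ℕ} (hf : f < m) (hh : h < m) (C : Set V) [DecidablePred (· ∈ C)]
    (hC : ∀ u v, H.Adj u v → c u v = f ∨ c u v = h → (u ∈ C ↔ v ∈ C)) :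
    IsEdgeCol H m fun u v => if u ∈ C then Equiv.swap f h (c u v) else c u v where
  symm u v huv := by
    rw [hc.symm v u huv.symm]
    by_cases hcol : c u v = f ∨ c u v = h
    · simp only [hC u v huv hcol]
    · push Not at hcol
      simp only [Equiv.swap_apply_of_ne_of_ne hcol.1 hcol.2, ite_self]
  lt u v huv := by
    have := hc.lt u v huv
    simp only [Equiv.swap_apply_def]
    split_ifs <;> assumption
  proper u v w huv huw := by
    intro e
    refine hc.proper u v w huv huw ?_
    by_cases hu : u ∈ C
    · simpa [hu] using e
    · simpa [hu] using e

/-- The subgraph of the edges colored `f` or `h`. -/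
def kempeGraph (H : SimpleGraph V) (c : V → V → ℕ) (f h : ℕ) : SimpleGraph V :=
  .fromRel fun u v => H.Adj u v ∧ (c u v = f ∨ c u v = h)

theorem IsEdgeCol.kempeGraph_adj {H : SimpleGraph V} {m : ℕ} {c : V → V → ℕ}
    (hc : IsEdgeCol H m c) {f h : ℕ} {u v : V} :
    (kempeGraph H c f h).Adj u v ↔ H.Adj u v ∧ (c u v = f ∨ c u v = h) := by
  simp only [kempeGraph, SimpleGraph.fromRel_adj]
  constructor
  · rintro ⟨-, h1 | ⟨h1, h2⟩⟩
    · exact h1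
    · exact ⟨h1.symm, by rwa [hc.symm u v h1.symm]⟩
  · exact fun h1 => ⟨h1.1.ne, Or.inl h1⟩

theorem IsEdgeCol.degree_kempeGraph_le [Fintype V] {H : SimpleGraph V} {m : ℕ} {c : V → V → ℕ}
    (hc : IsEdgeCol H m c) {f h : ℕ} [DecidableRel (kempeGraph H c f h).Adj] (v : V)
    (s : Finset ℕ) (hs : ∀ w, H.Adj v w → c v w = f ∨ c v w = h → c v w ∈ s) :
    (kempeGraph H c f h).degree v ≤ s.card := by
  rw [← SimpleGraph.card_neighborFinset_eq_degree]
  refine Finset.card_le_card_of_injOn (c v) ?_ ?_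
  · intro w hw
    have hw := hc.kempeGraph_adj.1 ((SimpleGraph.mem_neighborFinset _ _ _).1 hw)
    exact hs w hw.1 hw.2
  · intro w hw a ha e
    have hw := hc.kempeGraph_adj.1 ((SimpleGraph.mem_neighborFinset _ _ _).1 hw)
    have ha := hc.kempeGraph_adj.1 ((SimpleGraph.mem_neighborFinset _ _ _).1 ha)
    exact hc.proper v w a hw.1 ha.1 e

/-- No proper edge coloring of `H` with `m` colors has a color missing at both `x` and `y`. -/
def NoCommonMissing (H : SimpleGraph V) (m : ℕ) (x y : V) : Prop :=
  ∀ c, IsEdgeCol H m c → ∀ k < m, MissesColor H c x k → ¬ MissesColor H c y k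

/-- Kempe exchange at `z` of a color missing at `x` and a color missing at `y`, one of which is
also missing at `z`. -/
theorem NoCommonMissing.exists_swap [Fintype V] {H : SimpleGraph V} {m : ℕ} {x y z : V}
    (hne : NoCommonMissing H m x y) {c : V → V → ℕ} (hc : IsEdgeCol H m c) (hxy : x ≠ y)
    (hxz : x ≠ z) (hyz : y ≠ z) {f h : ℕ} (hf : f < m) (hh : h < m) (hfx : MissesColor H c x f)
    (hhy : MissesColor H c y h) (hz : MissesColor H c z f ∨ MissesColor H c z h) :
    ∃ c', IsEdgeCol H m c' ∧ (∀ v, c' x v = c x v) ∧ (∀ v, c' y v = c y v) ∧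
      ∀ v, c' z v = Equiv.swap f h (c z v) := by
  classical
  let K := kempeGraph H c f h
  have hclosed : ∀ a, ∀ u v, H.Adj u v → c u v = f ∨ c u v = h →
      (u ∈ {w | K.Reachable a w} ↔ v ∈ {w | K.Reachable a w}) := by
    intro a u v huv hcol
    have hadj : K.Adj u v := hc.kempeGraph_adj.2 ⟨huv, hcol⟩
    exact ⟨fun hu => hu.trans hadj.reachable, fun hv => hv.trans hadj.symm.reachable⟩
  have hxyr : K.Reachable x y := by
    by_contra hr
    refine hne _ (hc.swap_on hf hh _ (hclosed y)) f hf (hfx.of_row_eq fun w => ?_)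
      (MissesColor.of_row_swap (f := f) (h := h) (c := c) (fun w => ?_) ?_)
    · exact if_neg fun hx : K.Reachable y x => hr hx.symm
    · exact if_pos (SimpleGraph.Reachable.refl y)
    · rwa [Equiv.swap_apply_left]
  have hxzr : ¬ K.Reachable x z := by
    intro hr
    have one_f : ∀ v, MissesColor H c v f → K.degree v ≤ 1 := fun v hv =>
      hc.degree_kempeGraph_le v {h} fun w hw e => by
        simpa using e.resolve_left (hv w hw)
    have one_h : ∀ v, MissesColor H c v h → K.degree v ≤ 1 := fun v hv =>
      hc.degree_kempeGraph_le v {f} fun w hw e => by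
        simpa using e.resolve_right (hv w hw)
    refine not_reachable_of_degree_le_two K (fun v => ?_) hxy hxz hyz (one_f x hfx) (one_h y hhy)
      (hz.elim (one_f z) (one_h z)) hxyr hr
    exact (hc.degree_kempeGraph_le v {f, h} fun w hw e => by simpa using e).trans
      Finset.card_le_two
  refine ⟨_, hc.swap_on hf hh _ (hclosed z), fun v => if_neg ?_, fun v => if_neg ?_,
    fun v => if_pos (SimpleGraph.Reachable.refl z)⟩
  · exact fun hr : K.Reachable z x => hxzr hr.symm
  · exact fun hr : K.Reachable z y => hxzr (hxyr.trans hr.symm)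

/-- A chain of common neighbors of `x` and `z` from `w` to `u`: the color of `zv` is the color of
`xv'` for the successor `v'` of `v`. All these shared colors are present at both `x` and `y`, while
the initial color, that of `xw`, is missing at `y`. -/
structure IsColorChain (H : SimpleGraph V) (c : V → V → ℕ) (x y z : V) (S : Set V) (w u : V) :
    Prop where
  adj : ∀ v ∈ S, H.Adj x v ∧ H.Adj z v
  next : ∀ v ∈ S, v = u ∨ ∃ v' ∈ S, c x v' = c z v ∧ ¬ MissesColor H c x (c z v) ∧
    ¬ MissesColor H c y (c z v)
  prev : ∀ v ∈ S, v = w ∨ ∃ v' ∈ S, c z v' = c x v ∧ ¬ MissesColor H c x (c x v) ∧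
    ¬ MissesColor H c y (c x v)
  left_mem : w ∈ S
  right_mem : u ∈ S
  start : MissesColor H c y (c x w)

theorem IsColorChain.of_swap {H : SimpleGraph V} {c c' : V → V → ℕ} {x y z : V} {S : Set V}
    {w u : V} (hS : IsColorChain H c x y z S w u) {f h : ℕ} (hfx : MissesColor H c x f)
    (hhy : MissesColor H c y h) (hx : ∀ v, c' x v = c x v) (hy : ∀ v, c' y v = c y v)
    (hz : ∀ v, c' z v = Equiv.swap f h (c z v)) : IsColorChain H c' x y z S w u := by
  have hfix : ∀ k, ¬ MissesColor H c x k → ¬ MissesColor H c y k → Equiv.swap f h k = k := by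
    intro k hkx hky
    refine Equiv.swap_apply_of_ne_of_ne ?_ ?_ <;> rintro rfl <;> contradiction
  have hpx : ∀ k, ¬ MissesColor H c x k → ¬ MissesColor H c' x k :=
    fun k hk hk' => hk (hk'.of_row_eq fun v => (hx v).symm)
  have hpy : ∀ k, ¬ MissesColor H c y k → ¬ MissesColor H c' y k :=
    fun k hk hk' => hk (hk'.of_row_eq fun v => (hy v).symm)
  refine ⟨hS.adj, fun v hv => ?_, fun v hv => ?_, hS.left_mem, hS.right_mem, ?_⟩
  · refine (hS.next v hv).imp_right ?_
    rintro ⟨v', hv', e, h1, h2⟩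
    rw [hz, hfix _ h1 h2]
    exact ⟨v', hv', by rw [hx, e], hpx _ h1, hpy _ h2⟩
  · refine (hS.prev v hv).imp_right ?_
    rintro ⟨v', hv', e, h1, h2⟩
    rw [hx]
    exact ⟨v', hv', by rw [hz, e, hfix _ h1 h2], hpx _ h1, hpy _ h2⟩
  · rw [hx]
    exact hS.start.of_row_eq hy

/-- Exchanging the colors of `xv` and `zv` for every `v` in a chain whose initial color is missing
at `z` and whose final color is missing at `x` makes the initial color missing at `x` and `y`. -/
theorem IsColorChain.false_of_rotate {H : SimpleGraph V} {m : ℕ} {x y z : V}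
    (hne : NoCommonMissing H m x y) {c : V → V → ℕ} (hc : IsEdgeCol H m c) (hxy : x ≠ y)
    (hxz : x ≠ z) (hyz : y ≠ z) (hadj : ¬ H.Adj x y) {S : Set V} {w u : V}
    (hS : IsColorChain H c x y z S w u) (hz : MissesColor H c z (c x w))
    (hx : MissesColor H c x (c z u)) : False := by
  classical
  have hxS : x ∉ S := fun h => (hS.adj x h).1.ne rfl
  have hzS : z ∉ S := fun h => (hS.adj z h).2.ne rfl
  have hyS : y ∉ S := fun h => hadj (hS.adj y h).1
  have hfix : ∀ v, v ≠ x → v ≠ z → Equiv.swap x z v = v :=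
    fun v h1 h2 => Equiv.swap_apply_of_ne_of_ne h1 h2
  have hfixS : ∀ v ∈ S, Equiv.swap x z v = v := fun v hv =>
    hfix v (fun e => hxS (e ▸ hv)) fun e => hzS (e ▸ hv)
  have hadjS : ∀ v ∈ S, ∀ a, H.Adj v a → H.Adj v (Equiv.swap x z a) := by
    intro v hv a hva
    by_cases h1 : a = x
    · rw [h1, Equiv.swap_apply_left]; exact (hS.adj v hv).2.symm
    by_cases h2 : a = z
    · rw [h2, Equiv.swap_apply_right]; exact (hS.adj v hv).1.symm
    rwa [hfix a h1 h2]
  let c' : V → V → ℕ := fun a b =>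
    if a ∈ S then c a (Equiv.swap x z b) else if b ∈ S then c (Equiv.swap x z a) b else c a b
  have hnext : ∀ v ∈ S, ∀ b, H.Adj x b → c z v = c x b → b ∈ S := by
    intro v hv b hb e
    rcases hS.next v hv with rfl | ⟨v', hv', e', -⟩
    · exact absurd e.symm (hx b hb)
    · rwa [hc.proper x b v' hb (hS.adj v' hv').1 (by rw [e', e])]
  have hprev : ∀ v ∈ S, ∀ b, H.Adj z b → c x v = c z b → b ∈ S := by
    intro v hv b hb e
    rcases hS.prev v hv with rfl | ⟨v', hv', e', -⟩
    · exact absurd e.symm (hz b hb)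
    · rwa [hc.proper z b v' hb (hS.adj v' hv').2 (by rw [e', e])]
  have hc'x : ∀ b, c' x b = if b ∈ S then c z b else c x b := by
    intro b; simp only [c', if_neg hxS, Equiv.swap_apply_left]
  have hc'z : ∀ b, c' z b = if b ∈ S then c x b else c z b := by
    intro b; simp only [c', if_neg hzS, Equiv.swap_apply_right]
  have hc' : IsEdgeCol H m c' := by
    refine ⟨fun a b hab => ?_, fun a b hab => ?_, fun a b d hab had e => ?_⟩
    · by_cases ha : a ∈ S <;> by_cases hb : b ∈ S
      · simp only [c', if_pos ha, if_pos hb, hfixS a ha, hfixS b hb]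
        exact hc.symm a b hab
      · simp only [c', if_pos ha, if_neg hb]
        exact hc.symm _ _ (hadjS a ha b hab)
      · simp only [c', if_neg ha, if_pos hb]
        exact hc.symm _ _ (hadjS b hb a hab.symm).symm
      · simp only [c', if_neg ha, if_neg hb]
        exact hc.symm _ _ hab
    · simp only [c']
      split_ifs with ha hb
      · exact hc.lt _ _ (hadjS a ha b hab)
      · exact hc.lt _ _ (hadjS b hb a hab.symm).symm
      · exact hc.lt _ _ hab
    · by_cases ha : a ∈ S
      · simp only [c', if_pos ha] at e
        exact (Equiv.swap x z).injective
          (hc.proper a _ _ (hadjS a ha b hab) (hadjS a ha d had) e)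
      by_cases hax : a = x
      · subst hax
        rw [hc'x, hc'x] at e
        split_ifs at e with hb hd hd
        · exact hc.proper z b d (hS.adj b hb).2 (hS.adj d hd).2 e
        · exact absurd (hnext b hb d had e) hd
        · exact absurd (hnext d hd b hab e.symm) hb
        · exact hc.proper _ b d hab had e
      by_cases haz : a = z
      · subst haz
        rw [hc'z, hc'z] at e
        split_ifs at e with hb hd hd
        · exact hc.proper x b d (hS.adj b hb).1 (hS.adj d hd).1 e
        · exact absurd (hprev b hb d had e) hd
        · exact absurd (hprev d hd b hab e.symm) hb
        · exact hc.proper _ b d hab had e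
      simp only [c', if_neg ha, hfix a hax haz, ite_self] at e
      exact hc.proper a b d hab had e
  refine hne c' hc' (c x w) (hc.lt _ _ (hS.adj w hS.left_mem).1) (fun b hb e => ?_)
    (hS.start.of_row_eq fun b => ?_)
  · rw [hc'x] at e
    split_ifs at e with hbS
    · exact hz b (hS.adj b hbS).2 e
    · exact hbS (hc.proper x b w hb (hS.adj w hS.left_mem).1 e ▸ hS.left_mem)
  · simp only [c', if_neg hyS, hfix y hxy.symm hyz, ite_self]

section Chain

variable [Fintype V] {H : SimpleGraph V} {m : ℕ} {x y z : V} {c : V → V → ℕ} {S : Set V} {w u : V}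

theorem IsColorChain.false_of_last_missing_left (hne : NoCommonMissing H m x y)
    (hc : IsEdgeCol H m c) (hxy : x ≠ y) (hxz : x ≠ z) (hyz : y ≠ z) (hadj : ¬ H.Adj x y)
    (hS : IsColorChain H c x y z S w u) (hg : MissesColor H c x (c z u)) {f : ℕ} (hf : f < m)
    (hfx : MissesColor H c x f) (hfz : MissesColor H c z f) : False := by
  have hxw := (hS.adj w hS.left_mem).1
  have hzu := (hS.adj u hS.right_mem).2
  obtain ⟨c', hc', hx', hy', hz'⟩ := hne.exists_swap hc hxy hxz hyz hf (hc.lt _ _ hxw) hfx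
    hS.start (.inl hfz)
  refine (hS.of_swap hfx hS.start hx' hy' hz').false_of_rotate hne hc' hxy hxz hyz hadj
    (.of_row_swap hz' ?_) ?_
  · rwa [hx', Equiv.swap_apply_right]
  · rw [hz', Equiv.swap_apply_of_ne_of_ne (hfz u hzu) fun e => hg w hxw e.symm]
    exact hg.of_row_eq hx'

theorem IsColorChain.false_of_first_missing (hne : NoCommonMissing H m x y)
    (hc : IsEdgeCol H m c) (hxy : x ≠ y) (hxz : x ≠ z) (hyz : y ≠ z) (hadj : ¬ H.Adj x y)
    (hS : IsColorChain H c x y z S w u) (hg : MissesColor H c y (c z u)) {f : ℕ} (hf : f < m)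
    (hfx : MissesColor H c x f) (hfz : MissesColor H c z f)
    (hj : MissesColor H c z (c x w) ∨ c x w = c z u) : False := by
  have hxw := (hS.adj w hS.left_mem).1
  have hzu := (hS.adj u hS.right_mem).2
  obtain ⟨c', hc', hx', hy', hz'⟩ := hne.exists_swap hc hxy hxz hyz hf (hc.lt _ _ hzu) hfx
    hg (.inl hfz)
  refine (hS.of_swap hfx hg hx' hy' hz').false_of_rotate hne hc' hxy hxz hyz hadj
    (.of_row_swap hz' ?_) ?_
  · rw [hx']
    by_cases e : c x w = c z u
    · rwa [e, Equiv.swap_apply_right]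
    · rw [Equiv.swap_apply_of_ne_of_ne (hfx w hxw) e]
      exact hj.resolve_right e
  · rw [hz', Equiv.swap_apply_right]
    exact hfx.of_row_eq hx'

theorem IsColorChain.false_of_last_missing_right (hne : NoCommonMissing H m x y)
    (hc : IsEdgeCol H m c) (hxy : x ≠ y) (hxz : x ≠ z) (hyz : y ≠ z) (hadj : ¬ H.Adj x y)
    (hS : IsColorChain H c x y z S w u) (hg : MissesColor H c y (c z u)) {f b : ℕ} (hf : f < m)
    (hfx : MissesColor H c x f) (hfz : MissesColor H c z f) (hb : b < m) (hbf : b ≠ f)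
    (hbz : MissesColor H c z b) (hbxy : MissesColor H c x b ∨ MissesColor H c y b) : False := by
  have hxw := (hS.adj w hS.left_mem).1
  have hzu := (hS.adj u hS.right_mem).2
  by_cases hj : MissesColor H c z (c x w) ∨ c x w = c z u
  · exact hS.false_of_first_missing hne hc hxy hxz hyz hadj hg hf hfx hfz hj
  push Not at hj
  have hjb : b ≠ c x w := fun e => hj.1 (e ▸ hbz)
  obtain ⟨c', hc', hx', hy', hz'⟩ := hne.exists_swap hc hxy hxz hyz hf (hc.lt _ _ hxw) hfx
    hS.start (.inl hfz)
  have hS' := hS.of_swap hfx hS.start hx' hy' hz'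
  have hzu' : c' z u = c z u := by
    rw [hz', Equiv.swap_apply_of_ne_of_ne (hfz u hzu) hj.2.symm]
  have hg' : MissesColor H c' y (c' z u) := by rw [hzu']; exact hg.of_row_eq hy'
  have hj' : MissesColor H c' z (c' x w) :=
    .of_row_swap hz' (by rwa [hx', Equiv.swap_apply_right])
  have hbz' : MissesColor H c' z b :=
    .of_row_swap hz' (by rwa [Equiv.swap_apply_of_ne_of_ne hbf hjb])
  rcases hbxy with hbx | hby
  · exact hS'.false_of_first_missing hne hc' hxy hxz hyz hadj hg' hb (hbx.of_row_eq hx') hbz'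
      (.inl hj')
  · have hfx' := hfx.of_row_eq hx'
    have hby' := hby.of_row_eq hy'
    obtain ⟨c₂, hc₂, hx₂, hy₂, hz₂⟩ := hne.exists_swap hc' hxy hxz hyz hf hb hfx' hby' (.inr hbz')
    have hzu₂ : c₂ z u = c' z u := by
      rw [hz₂, Equiv.swap_apply_of_ne_of_ne _ (hbz' u hzu)]
      rw [hzu']
      exact hfz u hzu
    refine (hS'.of_swap hfx' hby' hx₂ hy₂ hz₂).false_of_first_missing hne hc₂ hxy hxz hyz hadj
      ?_ hf (hfx'.of_row_eq hx₂) (.of_row_swap hz₂ ?_) (.inl (.of_row_swap hz₂ ?_))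
    · rw [hzu₂]; exact hg'.of_row_eq hy₂
    · rwa [Equiv.swap_apply_left]
    · rw [hx₂, Equiv.swap_apply_of_ne_of_ne (hfx' w hxw)]
      · exact hj'
      · rw [hx']; exact hjb.symm

theorem IsColorChain.false_of_two_missing (hne : NoCommonMissing H m x y)
    (hc : IsEdgeCol H m c) (hxy : x ≠ y) (hxz : x ≠ z) (hyz : y ≠ z) (hadj : ¬ H.Adj x y)
    (hS : IsColorChain H c x y z S w u)
    (hg : MissesColor H c x (c z u) ∨ MissesColor H c y (c z u)) {f a b : ℕ} (hf : f < m)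
    (hfx : MissesColor H c x f) (ha : a < m) (hb : b < m) (hab : a ≠ b)
    (haz : MissesColor H c z a) (hbz : MissesColor H c z b)
    (haxy : MissesColor H c x a ∨ MissesColor H c y a)
    (hbxy : MissesColor H c x b ∨ MissesColor H c y b) : False := by
  have hzu := (hS.adj u hS.right_mem).2
  have hgm := hc.lt _ _ hzu
  by_cases hax : MissesColor H c x a
  · rcases hg with hg | hg
    · exact hS.false_of_last_missing_left hne hc hxy hxz hyz hadj hg ha hax haz
    · exact hS.false_of_last_missing_right hne hc hxy hxz hyz hadj hg ha hax haz hb hab.symm hbz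
        hbxy
  by_cases hbx : MissesColor H c x b
  · rcases hg with hg | hg
    · exact hS.false_of_last_missing_left hne hc hxy hxz hyz hadj hg hb hbx hbz
    · exact hS.false_of_last_missing_right hne hc hxy hxz hyz hadj hg hb hbx hbz ha hab haz haxy
  have hay := haxy.resolve_left hax
  have hby := hbxy.resolve_left hbx
  rcases hg with hg | hg
  · obtain ⟨c', hc', hx', hy', hz'⟩ := hne.exists_swap hc hxy hxz hyz hgm ha hg hay (.inr haz)
    refine (hS.of_swap hg hay hx' hy' hz').false_of_last_missing_right hne hc' hxy hxz hyz hadj ?_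
      hgm (hg.of_row_eq hx') (.of_row_swap hz' ?_) hb (hbz u hzu).symm (.of_row_swap hz' ?_)
      (.inr (hby.of_row_eq hy'))
    · rw [hz', Equiv.swap_apply_left]; exact hay.of_row_eq hy'
    · rwa [Equiv.swap_apply_left]
    · rwa [Equiv.swap_apply_of_ne_of_ne (hbz u hzu).symm hab.symm]
  · have hbf : b ≠ f := fun e => hbx (e ▸ hfx)
    obtain ⟨c', hc', hx', hy', hz'⟩ := hne.exists_swap hc hxy hxz hyz hf ha hfx hay (.inr haz)
    refine (hS.of_swap hfx hay hx' hy' hz').false_of_last_missing_right hne hc' hxy hxz hyz hadj ?_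
      hf (hfx.of_row_eq hx') (.of_row_swap hz' ?_) hb hbf (.of_row_swap hz' ?_)
      (.inr (hby.of_row_eq hy'))
    · rw [hz', Equiv.swap_apply_of_ne_of_ne _ (haz u hzu)]
      · exact hg.of_row_eq hy'
      · rintro e
        exact hne c hc f hf hfx (e ▸ hg)
    · rwa [Equiv.swap_apply_left]
    · rwa [Equiv.swap_apply_of_ne_of_ne hbf hab.symm]

end Chain

/-- An injective partial map with more arrows than there are elements of `R` has a trajectory that
starts outside `R`, runs inside `R` and ends outside `R`. -/
theorem exists_trajectory {α β : Type*} (W : Finset α) (a b : α → β) (ha : Set.InjOn a W)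
    (hb : Set.InjOn b W) (R : Finset β) (hR : R.card < W.card) :
    ∃ w ∈ W, a w ∉ R ∧ ∃ u ∈ W, b u ∉ R ∧
      Relation.ReflTransGen (fun p q => p ∈ W ∧ q ∈ W ∧ b p = a q ∧ b p ∈ R) w u := by
  classical
  by_contra! hcon
  set r : α → α → Prop := fun p q => p ∈ W ∧ q ∈ W ∧ b p = a q ∧ b p ∈ R
  let T := W.filter fun v => ∃ w ∈ W, a w ∉ R ∧ Relation.ReflTransGen r w v
  have hT : T ⊆ W := Finset.filter_subset _ _
  have h1 : T.image b ⊆ R := by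
    intro k hk
    obtain ⟨v, hv, rfl⟩ := Finset.mem_image.1 hk
    obtain ⟨hvW, w, hw, haw, hwv⟩ := Finset.mem_filter.1 hv
    by_contra hbv
    exact hcon w hw haw v hvW hbv hwv
  have h2 : (W \ T).image a ⊆ R := by
    intro k hk
    obtain ⟨v, hv, rfl⟩ := Finset.mem_image.1 hk
    obtain ⟨hvW, hvT⟩ := Finset.mem_sdiff.1 hv
    by_contra hav
    exact hvT (Finset.mem_filter.2 ⟨hvW, v, hvW, hav, .refl⟩)
  have h3 : Disjoint (T.image b) ((W \ T).image a) := by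
    refine Finset.disjoint_left.2 fun k hk hk' => ?_
    obtain ⟨p, hp, rfl⟩ := Finset.mem_image.1 hk
    obtain ⟨q, hq, e⟩ := Finset.mem_image.1 hk'
    obtain ⟨hqW, hqT⟩ := Finset.mem_sdiff.1 hq
    obtain ⟨hpW, w, hw, haw, hwp⟩ := Finset.mem_filter.1 hp
    exact hqT (Finset.mem_filter.2 ⟨hqW, w, hw, haw, hwp.tail ⟨hpW, hqW, e.symm, h1 hk⟩⟩)
  have h4 := Finset.card_le_card (Finset.union_subset h1 h2)
  rw [Finset.card_union_of_disjoint h3, Finset.card_image_of_injOn (hb.mono hT),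
    Finset.card_image_of_injOn (ha.mono Finset.sdiff_subset)] at h4
  have := Finset.card_sdiff_add_card_eq_card hT
  omega

/-- The two-edge fan at `x` cannot be colored when its second edge `xz` carries a color missing at
`y`, unless `z` sees all colors missing at `x` or `y`. -/
theorem NoCommonMissing.not_missing_of_fan [Fintype V] {H : SimpleGraph V} {m : ℕ} {x y z : V}
    (hne : NoCommonMissing H m x y) {c : V → V → ℕ} (hc : IsEdgeCol H m c) (hxy : x ≠ y)
    (hyz : y ≠ z) (hadj : H.Adj x z) (hk : MissesColor H c y (c x z)) {f a : ℕ} (hf : f < m)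
    (hfx : MissesColor H c x f) (ha : a < m) (haxy : MissesColor H c x a ∨ MissesColor H c y a) :
    ¬ MissesColor H c z a := by
  classical
  have key : ∀ c, IsEdgeCol H m c → MissesColor H c y (c x z) → ∀ a < m, MissesColor H c x a →
      ¬ MissesColor H c z a := by
    intro c hc hk a ha hax haz
    let c' : V → V → ℕ := fun u v => if s(u, v) = s(x, z) then a else c u v
    have hmiss : ∀ u v w, H.Adj u w → s(u, v) = s(x, z) → c u w ≠ a := by
      intro u v w huw e
      rcases Sym2.eq_iff.1 e with ⟨rfl, -⟩ | ⟨rfl, -⟩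
      · exact hax w huw
      · exact haz w huw
    have hc' : IsEdgeCol H m c' := by
      refine ⟨fun u v huv => ?_, fun u v huv => ?_, fun u v w huv huw e => ?_⟩
      · simp only [c', Sym2.eq_swap (a := v), hc.symm u v huv]
      · simp only [c']
        split_ifs
        exacts [ha, hc.lt u v huv]
      · simp only [c'] at e
        split_ifs at e with h1 h2 h2
        · exact Sym2.congr_right.1 (h1.trans h2.symm)
        · exact absurd e.symm (hmiss u v w huw h1)
        · exact absurd e (hmiss u w v huv h2)
        · exact hc.proper u v w huv huw e
    refine hne c' hc' (c x z) (hc.lt x z hadj) (fun v hv e => ?_) (hk.of_row_eq fun v => ?_)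
    · simp only [c'] at e
      split_ifs at e with h1
      · exact hax z hadj e.symm
      · exact h1 (by rw [hc.proper x v z hv hadj e])
    · refine if_neg fun e => ?_
      rcases Sym2.eq_iff.1 e with ⟨h, -⟩ | ⟨h, -⟩
      exacts [hxy h.symm, hyz h]
  rcases haxy with hax | hay
  · exact key c hc hk a ha hax
  · intro haz
    obtain ⟨c', hc', hx', hy', hz'⟩ := hne.exists_swap hc hxy hadj.ne hyz hf ha hfx hay (.inr haz)
    refine key c' hc' ?_ f hf (hfx.of_row_eq hx') (.of_row_swap hz' ?_)
    · rw [hx']; exact hk.of_row_eq hy'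
    · rwa [Equiv.swap_apply_left]

theorem IsEdgeCol.card_image_row [Fintype V] {H : SimpleGraph V} {m : ℕ} {c : V → V → ℕ}
    (hc : IsEdgeCol H m c) [DecidableRel H.Adj] (v : V) :
    ((H.neighborFinset v).image (c v)).card = H.degree v := by
  rw [Finset.card_image_of_injOn, SimpleGraph.card_neighborFinset_eq_degree]
  intro w hw w' hw' e
  exact hc.proper v w w' (by simpa using hw) (by simpa using hw') e

theorem NoCommonMissing.not_isEdgeCol [Fintype V] [DecidableEq V] {H : SimpleGraph V}
    [DecidableRel H.Adj] {m : ℕ}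
    {x y z : V} (hne : NoCommonMissing H m x y) (hxy : x ≠ y) (hyz : y ≠ z) (hadj : ¬ H.Adj x y)
    (hxz : H.Adj x z) (hx : H.degree x < m) (hsum : H.degree z + H.degree x + H.degree y < 2 * m)
    (htri : H.degree x + H.degree y ≤ (H.neighborFinset x ∩ H.neighborFinset z).card + m)
    (c : V → V → ℕ) : ¬ IsEdgeCol H m c := by
  intro hc
  let P : V → Finset ℕ := fun v => (H.neighborFinset v).image (c v)
  have hPcard : ∀ v, (P v).card = H.degree v := hc.card_image_row
  have hPlt : ∀ v, P v ⊆ Finset.range m := by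
    intro v k hk
    obtain ⟨w, hw, rfl⟩ := Finset.mem_image.1 hk
    exact Finset.mem_range.2 (hc.lt v w (by simpa using hw))
  have hmiss : ∀ v k, MissesColor H c v k ↔ k ∉ P v := by
    intro v k
    simp [P, MissesColor]
  let M : V → Finset ℕ := fun v => Finset.range m \ P v
  have hMmem : ∀ v k, k ∈ M v ↔ k < m ∧ MissesColor H c v k := by
    intro v k
    simp [M, hmiss]
  have hMcard : ∀ v, (M v).card + H.degree v = m := by
    intro v
    rw [← hPcard, Finset.card_sdiff_add_card_eq_card (hPlt v), Finset.card_range]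
  have hdisj : Disjoint (M x) (M y) := Finset.disjoint_left.2 fun k hkx hky =>
    hne c hc k ((hMmem x k).1 hkx).1 ((hMmem x k).1 hkx).2 ((hMmem y k).1 hky).2
  let U := M x ∪ M y
  have hUcard : U.card = (M x).card + (M y).card := Finset.card_union_of_disjoint hdisj
  have hUmem : ∀ k, k ∈ U ↔ k < m ∧ (MissesColor H c x k ∨ MissesColor H c y k) := by
    intro k
    rw [Finset.mem_union, hMmem, hMmem, ← and_or_left]
  have hUsub : U ⊆ Finset.range m := Finset.union_subset Finset.sdiff_subset Finset.sdiff_subset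
  obtain ⟨f, hfM⟩ : (M x).Nonempty := by
    rw [← Finset.card_pos]
    have := hMcard x
    omega
  obtain ⟨hf, hfx⟩ := (hMmem x f).1 hfM
  have hMx := hMcard x
  have hMy := hMcard y
  have hPz := hPcard z
  have hqz : c x z ∈ P z := Finset.mem_image.2
    ⟨x, by simpa using hxz.symm, (hc.symm x z hxz).symm⟩
  have hqm : c x z < m := hc.lt x z hxz
  by_cases hk : MissesColor H c y (c x z)
  · obtain ⟨a, haU, haz⟩ : ∃ a ∈ U, a ∉ P z := Finset.exists_mem_notMem_of_card_lt_card (by omega)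
    exact hne.not_missing_of_fan hc hxy hyz hxz hk hf hfx ((hUmem a).1 haU).1 ((hUmem a).1 haU).2
      ((hmiss z a).2 haz)
  have hqU : c x z ∉ U := fun h => ((hUmem _).1 h).2.elim (fun h => h z hxz rfl) hk
  obtain ⟨a, ha, b, hb, hab⟩ : ∃ a ∈ U \ P z, ∃ b ∈ U \ P z, a ≠ b := by
    refine Finset.one_lt_card.1 ?_
    have h1 : U \ P z = U \ (P z).erase (c x z) := by
      ext k
      simp only [Finset.mem_sdiff, Finset.mem_erase]
      grind
    have h2 := Finset.le_card_sdiff ((P z).erase (c x z)) U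
    rw [h1]
    rw [Finset.card_erase_of_mem hqz] at h2
    have := Finset.card_pos.2 ⟨_, hqz⟩
    omega
  rw [Finset.mem_sdiff, hUmem, ← hmiss] at ha hb
  let W := H.neighborFinset x ∩ H.neighborFinset z
  have hW : ∀ v, v ∈ W ↔ H.Adj x v ∧ H.Adj z v := by intro v; simp [W]
  let R := (Finset.range m \ U).erase (c x z)
  have hRmem : ∀ k, k ∈ R ↔ k ≠ c x z ∧ k < m ∧ ¬ MissesColor H c x k ∧ ¬ MissesColor H c y k := by
    intro k
    rw [Finset.mem_erase, Finset.mem_sdiff, Finset.mem_range, hUmem]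
    exact ⟨fun ⟨h1, h2, h3⟩ => ⟨h1, h2, fun h => h3 ⟨h2, .inl h⟩, fun h => h3 ⟨h2, .inr h⟩⟩,
      fun ⟨h1, h2, h3, h4⟩ => ⟨h1, h2, fun h => h.2.elim h3 h4⟩⟩
  have hRcard : R.card < W.card := by
    have hq : c x z ∈ Finset.range m \ U := Finset.mem_sdiff.2 ⟨Finset.mem_range.2 hqm, hqU⟩
    have h1 := Finset.card_sdiff_add_card_eq_card hUsub
    have h2 := Finset.card_erase_add_one hq
    rw [Finset.card_range] at h1
    change R.card + 1 = _ at h2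
    change _ ≤ W.card + m at htri
    omega
  obtain ⟨w, hwW, haw, u, huW, hbu, hwu⟩ := exists_trajectory W (c x) (c z)
    (fun v hv v' hv' e => hc.proper x v v' ((hW v).1 hv).1 ((hW v').1 hv').1 e)
    (fun v hv v' hv' e => hc.proper z v v' ((hW v).1 hv).2 ((hW v').1 hv').2 e) R hRcard
  obtain ⟨hxw, hzw⟩ := (hW w).1 hwW
  obtain ⟨hxu, hzu⟩ := (hW u).1 huW
  have hwq : c x w ≠ c x z := fun e => hzw.ne (hc.proper x w z hxw hxz e).symm
  have huq : c z u ≠ c x z := fun e => hxu.ne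
    (hc.proper z u x hzu hxz.symm (e.trans (hc.symm x z hxz))).symm
  have hstart : MissesColor H c y (c x w) := by
    by_contra hn
    exact haw ((hRmem _).2 ⟨hwq, hc.lt x w hxw, fun h => h w hxw rfl, hn⟩)
  have hend : MissesColor H c x (c z u) ∨ MissesColor H c y (c z u) := by
    by_contra! hn
    exact hbu ((hRmem _).2 ⟨huq, hc.lt z u hzu, hn⟩)
  set r : V → V → Prop := fun p q => p ∈ W ∧ q ∈ W ∧ c z p = c x q ∧ c z p ∈ R
  have hS : IsColorChain H c x y z
      {v | Relation.ReflTransGen r w v ∧ Relation.ReflTransGen r v u} w u := by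
    refine ⟨?_, ?_, ?_, ⟨.refl, hwu⟩, ⟨hwu, .refl⟩, hstart⟩
    · rintro v ⟨h1, -⟩
      rcases h1.cases_tail with h | ⟨p, -, h⟩
      · rw [h]; exact ⟨hxw, hzw⟩
      · exact (hW v).1 h.2.1
    · rintro v ⟨h1, h2⟩
      rcases h2.cases_head with h | ⟨p, hp, hpu⟩
      · exact .inl h
      · exact .inr ⟨p, ⟨h1.tail hp, hpu⟩, hp.2.2.1.symm, ((hRmem _).1 hp.2.2.2).2.2⟩
    · rintro v ⟨h1, h2⟩
      rcases h1.cases_tail with h | ⟨p, hwp, hp⟩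
      · exact .inl h
      · refine .inr ⟨p, ⟨hwp, h2.head hp⟩, hp.2.2.1, ?_⟩
        rw [← hp.2.2.1]
        exact ((hRmem _).1 hp.2.2.2).2.2
  exact hS.false_of_two_missing hne hc hxy hxz.ne hyz hadj hend hf hfx ha.1.1 hb.1.1 hab ha.2 hb.2
    ha.1.2 hb.1.2

theorem IsEdgeCol.isProperEdgeColoring {G : SimpleGraph V} {m : ℕ} {c : V → V → ℕ}
    (hc : IsEdgeCol G m c) : ∃ c', IsProperEdgeColoring G m c' := by
  let c' : Sym2 V → ℕ := Sym2.lift ⟨fun u v => max (c u v) (c v u), fun u v => max_comm _ _⟩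
  have hc' : ∀ u v, G.Adj u v → c' s(u, v) = c u v := by
    intro u v huv
    simp [c', hc.symm u v huv]
  refine ⟨c', fun e he => ?_, ?_⟩
  · induction e with | _ u v =>
    rw [hc' u v he]
    exact hc.lt u v he
  · rintro e₁ h₁ e₂ h₂ hne ⟨v, hv₁, hv₂⟩ e
    obtain ⟨a, rfl⟩ := hv₁
    obtain ⟨b, rfl⟩ := hv₂
    rw [hc' v a h₁, hc' v b h₂] at e
    exact hne (by rw [hc.proper v a b h₁ h₂ e])

theorem IsProperEdgeColoring.isEdgeCol {G : SimpleGraph V} {m : ℕ} {c : Sym2 V → ℕ}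
    (hc : IsProperEdgeColoring G m c) : IsEdgeCol G m fun u v => c s(u, v) := by
  refine ⟨fun u v _ => by rw [Sym2.eq_swap], fun u v huv => hc.1 _ huv, fun u v w huv huw e => ?_⟩
  by_contra hvw
  exact hc.2 s(u, v) huv s(u, w) huw (fun h => hvw (Sym2.congr_right.1 h))
    ⟨u, Sym2.mem_mk_left u v, Sym2.mem_mk_left u w⟩ e

theorem IsProperEdgeColoring.mono {G : SimpleGraph V} {m n : ℕ} {c : Sym2 V → ℕ}
    (hc : IsProperEdgeColoring G m c) (hmn : m ≤ n) : IsProperEdgeColoring G n c :=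
  ⟨fun e he => (hc.1 e he).trans_le hmn, hc.2⟩

theorem exists_isProperEdgeColoring_edgeChromaticNumber [Finite V] (G : SimpleGraph V) :
    ∃ c, IsProperEdgeColoring G (edgeChromaticNumber G) c := by
  refine Nat.sInf_mem (s := {n | ∃ c, IsProperEdgeColoring G n c}) ?_
  obtain ⟨n, ⟨φ⟩⟩ := Finite.exists_equiv_fin (Sym2 V)
  exact ⟨n, fun e => φ e, fun e _ => (φ e).2, fun e₁ _ e₂ _ hne _ h =>
    hne (φ.injective (Fin.ext h))⟩

theorem deg_eq_degree [Fintype V] (G : SimpleGraph V) [DecidableRel G.Adj] (v : V) :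
    deg G v = G.degree v := by
  rw [deg, ← SimpleGraph.card_neighborFinset_eq_degree, SimpleGraph.neighborFinset_def,
    Set.ncard_eq_toFinset_card']

theorem deg_le_maxDeg [Finite V] (G : SimpleGraph V) (v : V) : deg G v ≤ maxDeg G :=
  le_csSup (Set.finite_range (deg G)).bddAbove ⟨v, rfl⟩

theorem maxDeg_le_edgeChromaticNumber [Fintype V] (G : SimpleGraph V) :
    maxDeg G ≤ edgeChromaticNumber G := by
  classical
  obtain ⟨c, hc⟩ := exists_isProperEdgeColoring_edgeChromaticNumber G
  refine csSup_le' ?_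
  rintro _ ⟨v, rfl⟩
  rw [deg_eq_degree, ← hc.isEdgeCol.card_image_row v]
  refine (Finset.card_le_card (t := Finset.range (edgeChromaticNumber G)) fun k hk => ?_).trans_eq
    (Finset.card_range _)
  obtain ⟨w, hw, rfl⟩ := Finset.mem_image.1 hk
  exact Finset.mem_range.2 (hc.isEdgeCol.lt v w (by simpa using hw))

/-- Deleting an edge of a critical graph leaves a graph that has an edge coloring with one color
less than `G` needs. -/
theorem IsCritical.exists_isEdgeCol_deleteEdges [Fintype V] {G : SimpleGraph V}
    (hG : IsCritical G) {x y : V} (hxy : G.Adj x y) :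
    ∃ c, IsEdgeCol (G.deleteEdges {s(x, y)}) (edgeChromaticNumber G - 1) c := by
  classical
  let H : G.Subgraph := (⊤ : G.Subgraph).deleteEdges {s(x, y)}
  have hH : H ≠ ⊤ := by
    intro e
    have : H.Adj x y := by rw [e]; exact hxy
    simp [H] at this
  have hlt := hG.2 H hH
  obtain ⟨c, hc⟩ := exists_isProperEdgeColoring_edgeChromaticNumber H.coe
  have hc := (hc.mono (Nat.le_sub_one_of_lt hlt)).isEdgeCol
  have hv : ∀ v, v ∈ H.verts := fun v => by simp [H]
  have hadj : ∀ u v, (G.deleteEdges {s(x, y)}).Adj u v → H.coe.Adj ⟨u, hv u⟩ ⟨v, hv v⟩ := by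
    intro u v huv
    change H.Adj u v
    simpa [H] using huv
  refine ⟨fun u v => c s(⟨u, hv u⟩, ⟨v, hv v⟩), fun u v h => hc.symm _ _ (hadj u v h),
    fun u v h => hc.lt _ _ (hadj u v h), fun u v w h h' e => ?_⟩
  exact congrArg Subtype.val (hc.proper _ _ _ (hadj u v h) (hadj u w h') e)

theorem noCommonMissing_deleteEdges {G : SimpleGraph V} {m : ℕ} {x y : V} (hxy : x ≠ y)
    (hG : ¬ ∃ c, IsProperEdgeColoring G m c) :
    NoCommonMissing (G.deleteEdges {s(x, y)}) m x y := by
  classical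
  intro c hc k hk hkx hky
  let c' : V → V → ℕ := fun u v => if s(u, v) = s(x, y) then k else c u v
  have hadj : ∀ u v, G.Adj u v → s(u, v) ≠ s(x, y) → (G.deleteEdges {s(x, y)}).Adj u v :=
    fun u v h h' => SimpleGraph.deleteEdges_adj.2 ⟨h, h'⟩
  have hmiss : ∀ u v w, G.Adj u w → s(u, v) = s(x, y) → s(u, w) ≠ s(x, y) → c u w ≠ k := by
    intro u v w huw e hne
    rcases Sym2.eq_iff.1 e with ⟨rfl, -⟩ | ⟨rfl, -⟩
    · exact hkx w (hadj _ _ huw hne)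
    · exact hky w (hadj _ _ huw hne)
  refine hG (IsEdgeCol.isProperEdgeColoring (c := c') ⟨fun u v huv => ?_, fun u v huv => ?_,
    fun u v w huv huw e => ?_⟩)
  · simp only [c', Sym2.eq_swap (a := v)]
    split_ifs with h
    · rfl
    · exact hc.symm u v (hadj u v huv h)
  · simp only [c']
    split_ifs with h
    · exact hk
    · exact hc.lt u v (hadj u v huv h)
  · simp only [c'] at e
    split_ifs at e with h1 h2 h2
    · exact Sym2.congr_right.1 (h1.trans h2.symm)
    · exact absurd e.symm (hmiss u v w huw h1 h2)
    · exact absurd e (hmiss u w v huv h2 h1)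
    · exact hc.proper u v w (hadj u v huv h1) (hadj u w huw h2) e

theorem degree_deleteEdges_singleton_add_one [Fintype V] [DecidableEq V] {G : SimpleGraph V}
    [DecidableRel G.Adj] {x y : V} (hxy : G.Adj x y)
    [DecidableRel (G.deleteEdges {s(x, y)}).Adj] :
    (G.deleteEdges {s(x, y)}).degree x + 1 = G.degree x := by
  have : (G.deleteEdges {s(x, y)}).neighborFinset x = (G.neighborFinset x).erase y := by
    ext v
    simp only [SimpleGraph.mem_neighborFinset, SimpleGraph.deleteEdges_adj, Set.mem_singleton_iff,
      Sym2.congr_right, Finset.mem_erase]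
    tauto
  rw [← SimpleGraph.card_neighborFinset_eq_degree, this, Finset.card_erase_add_one (by simpa),
    SimpleGraph.card_neighborFinset_eq_degree]

/-- No critical graph has pairwise distinct vertices `x, y, z` such that `x`
is adjacent to `y` and `z`, `d(z) < 2Δ(G) − d(x) − d(y) + 2` (stated
additively to avoid truncated subtraction), and `xz` lies in at least
`d(x) + d(y) − Δ(G) − 2` triangles not containing `y`, i.e. `x` and `z` have
at least that many common neighbors distinct from `y`. -/
theorem no_critical_SZ_configuration [Fintype V] (G : SimpleGraph V)
    (hG : IsCritical G) :
    ¬ ∃ x y z : V, x ≠ y ∧ x ≠ z ∧ y ≠ z ∧ G.Adj x y ∧ G.Adj x z ∧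
      deg G z + deg G x + deg G y < 2 * maxDeg G + 2 ∧
      deg G x + deg G y ≤
        {w | G.Adj x w ∧ G.Adj z w ∧ w ≠ y}.ncard + maxDeg G + 2 := by
  classical
  rintro ⟨x, y, z, hxy, hxz, hyz, axy, axz, hsum, htri⟩
  set m := edgeChromaticNumber G - 1
  have hΔ : maxDeg G ≤ m := by
    have h1 := maxDeg_le_edgeChromaticNumber G
    have h2 := hG.1
    omega
  have hxΔ := deg_le_maxDeg G x
  simp only [deg_eq_degree] at hsum htri hxΔ
  have hpos : 0 < G.degree x := (G.degree_pos_iff_exists_adj x).2 ⟨y, axy⟩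
  have hχ : 0 < edgeChromaticNumber G := by
    have := maxDeg_le_edgeChromaticNumber G
    omega
  obtain ⟨c, hc⟩ := hG.exists_isEdgeCol_deleteEdges axy
  have hne : NoCommonMissing (G.deleteEdges {s(x, y)}) m x y :=
    noCommonMissing_deleteEdges hxy fun h =>
      Nat.notMem_of_lt_sInf (show m < edgeChromaticNumber G by omega) h
  have hdx := degree_deleteEdges_singleton_add_one axy
  have hdy : (G.deleteEdges {s(x, y)}).degree y + 1 = G.degree y := by
    have := degree_deleteEdges_singleton_add_one axy.symm
    rw [← this]
    congr! 3
    rw [Sym2.eq_swap]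
  have hdz : (G.deleteEdges {s(x, y)}).degree z ≤ G.degree z :=
    SimpleGraph.degree_le_of_le (G.deleteEdges_le _)
  have htri' : {w | G.Adj x w ∧ G.Adj z w ∧ w ≠ y}.ncard =
      ((G.deleteEdges {s(x, y)}).neighborFinset x ∩
        (G.deleteEdges {s(x, y)}).neighborFinset z).card := by
    rw [← Set.ncard_coe_finset]
    congr 1
    ext w
    simp only [Set.mem_ofPred_eq, Finset.coe_inter, SimpleGraph.coe_neighborFinset, Set.mem_inter_iff,
      SimpleGraph.mem_neighborSet, SimpleGraph.deleteEdges_adj, Set.mem_singleton_iff, Sym2.eq_iff]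
    grind
  refine hne.not_isEdgeCol hxy hyz (by simp) ?_ ?_ ?_ ?_ c hc
  · simp only [SimpleGraph.deleteEdges_adj, Set.mem_singleton_iff, Sym2.congr_right]
    exact ⟨axz, hyz.symm⟩
  all_goals omega
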